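/- (Main Lemma (iii)) Let e=(u,v) be a non-leaf-edge of depth d−1 in a rooted tree instance, assume all edges of depth at least d satisfy conditions (a) and (b), and let ⟨ã,b̃⟩ = Ψ(e1)⊗Ψ(e2) for the two child-edges e1, e2 of e. Let x1 ∈ Ψ(e1), x2 ∈ Ψ(e2), y ∈ [0, min{x1,x2}] and x = x1+x2−2y, and let f_i be a blocking flow of I(e_i) with f_i(e_i) = x_i (i=1,2). Then x ≥ ã, and if ã ≤ c(e) and x ≤ c(e), there is a blocking flow f of I(e) with f(e) = x that agrees with f1 on the edges of G_{e1} and with f2 on the edges of G_{e2}. -/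

import Mathlib

open Classical

/-- `⟨a,b⟩`: the set `{a, a+2, …, b}` of consecutive odd or even integers. -/
def Iv (a b : ℕ) : Set ℕ := {x | a ≤ x ∧ x ≤ b ∧ x % 2 = a % 2}

/-- `A ⊗ B = {a + b − 2i : a ∈ A, b ∈ B, 0 ≤ i ≤ min(a,b)}`. -/
def otimes (A B : Set ℕ) : Set ℕ :=
  {x | ∃ a ∈ A, ∃ b ∈ B, ∃ i, i ≤ min a b ∧ x = a + b - 2 * i}

/-- A tree instance `(G,T,c)` rooted at a terminal `r`: a tree on vertex set `V`,
encoded by the parent function `par` (with `par root = root`) together with a depth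
function certifying acyclicity.  Each non-root vertex `v` is identified with the edge
`(par v, v)`; `c v` is the (positive integer) capacity of that edge.  The terminals are
the leaves; the root has exactly one child and every internal vertex has exactly
two children (total degree 3). -/
structure RTI (V : Type*) where
  root : V
  par : V → V
  dep : V → ℕ
  c : V → ℕ
  par_root : par root = root
  dep_root : dep root = 0
  dep_par : ∀ v, v ≠ root → dep v = dep (par v) + 1
  cap_pos : ∀ v, v ≠ root → 1 ≤ c v
  root_degree : {w : V | par w = root ∧ w ≠ root}.ncard = 1
  internal_degree : ∀ v, v ≠ root → {w : V | par w = v ∧ w ≠ root}.Nonempty →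
    {w : V | par w = v ∧ w ≠ root}.ncard = 2

namespace RTI

variable {V : Type*} (R : RTI V)

/-- `R.below u v`: `v` lies in the subtree rooted at `u` (i.e. `u` is an ancestor of
`v`, allowing `u = v`). -/
def below (u v : V) : Prop :=
  Relation.ReflTransGen (fun a b => R.par b = a ∧ b ≠ R.root) u v

/-- `v` is a leaf of the tree other than the root. -/
def leaf (v : V) : Prop := v ≠ R.root ∧ ∀ w, w ≠ R.root → R.par w ≠ v

/-- The children of `v` (as lower endpoints of child-edges). -/
def children (v : V) : Set V := {w | R.par w = v ∧ w ≠ R.root}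

/-- For an edge `e = (par v, v)`, the vertex set `V_e` of the instance `I(e)`. -/
def Ve (v : V) : Set V := insert (R.par v) {w | R.below v w}

/-- `T_e`: the terminals of `I(e)` other than `u = par v`. -/
def Te (v : V) : Set V := {w | R.below v w ∧ R.leaf w}

/-- The full terminal set `T_e ∪ {u}` of the instance `I(e)`. -/
def S (v : V) : Set V := insert (R.par v) (R.Te v)

/-- The edge `(par x, x)` lies on the tree path between `t` and `t'`
(exactly one of `t, t'` is in the subtree below `x`). -/
def onPath (x t t' : V) : Prop :=
  (R.below x t ∧ ¬ R.below x t') ∨ (¬ R.below x t ∧ R.below x t')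

/-- The vertex `x` lies on the tree path between `t` and `t'`. -/
def onPathV (x t t' : V) : Prop :=
  (R.below x t ∨ R.below x t') ∧ ∀ z, R.below z t → R.below z t' → R.below z x

/-- Unordered pairs of distinct terminals of the instance `I(e)` for `e = (par v, v)`. -/
def PathPairs (v : V) : Set (Sym2 V) :=
  {p | ∃ t t', t ∈ R.S v ∧ t' ∈ R.S v ∧ t ≠ t' ∧ p = s(t, t')}

/-- `g` is a decomposition of `f` in the instance `I(e)`, `e = (par v, v)`:
`g` is supported on pairs of distinct terminals and, on every edge of `I(e)`,
`f` is the sum of `g` over the (unique) terminal-pair paths through that edge. -/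
def IsDecomp (v : V) (f : V → ℕ) (g : Sym2 V → ℕ) : Prop :=
  (∀ p, g p ≠ 0 → p ∈ R.PathPairs v) ∧
  ∀ w, R.below v w →
    f w = ∑ᶠ p ∈ {p : Sym2 V | ∃ t t', p = s(t, t') ∧ R.onPath w t t'}, g p

/-- `f` is an (integral) flow in the instance `I(e)`, `e = (par v, v)`. -/
def IsFlow (v : V) (f : V → ℕ) : Prop := ∃ g, R.IsDecomp v f g

/-- `f` is feasible in `I(e)`. -/
def Feasible (v : V) (f : V → ℕ) : Prop := ∀ w, R.below v w → f w ≤ R.c w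

/-- `V_f(s)`: the set of vertices `w` of `I(e)` reachable from `s` by travelling
upward along edges with `c − f ≥ 1` to a common ancestor and then downward along
edges with `c − f ≥ 2`. -/
def Vf (v : V) (f : V → ℕ) (s : V) : Set V :=
  {w | w ∈ R.Ve v ∧ ∃ z ∈ R.Ve v, R.below z s ∧ R.below z w ∧
    (∀ x, R.below z x → R.below x s → x ≠ z → f x + 1 ≤ R.c x) ∧
    (∀ x, R.below z x → R.below x w → x ≠ z → f x + 2 ≤ R.c x)}

/-- `W` induces a connected subgraph of the tree (it is closed under tree paths). -/
def ConnSet (W : Set V) : Prop :=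
  ∀ w₁ ∈ W, ∀ w₂ ∈ W, ∀ x, R.onPathV x w₁ w₂ → x ∈ W

/-- `E(X)` inside the instance `I(e)`, `e = (par v, v)`: the edges `(par x, x)` of
`I(e)` with exactly one endpoint in `X`. -/
def cutE (v : V) (X : Set V) : Set V :=
  {x | R.below v x ∧ ¬ (x ∈ X ↔ R.par x ∈ X)}

/-- `h(X) = Σ_{e' ∈ E(X)} h(e')` inside the instance `I(e)`, `e = (par v, v)`. -/
noncomputable def hval (v : V) (X : Set V) (h : V → ℕ) : ℕ := ∑ᶠ x ∈ R.cutE v X, h x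

/-- `W` is a connected component of the subgraph of `I(e)` induced by `A`. -/
def IsComp (v : V) (A W : Set V) : Prop :=
  W.Nonempty ∧ W ⊆ A ∧ R.ConnSet W ∧
  (∀ x, R.below v x → x ∈ W → R.par x ∈ A → R.par x ∈ W) ∧
  (∀ x, R.below v x → R.par x ∈ W → x ∈ A → x ∈ W)

/-- `odd(X)` (relative to the union `U` of the removed terminal sets): the components
`W` of `G_e − U` with `c(W)` odd whose parent-edge is a child-edge of `X`. -/
def oddOf (v : V) (U X : Set V) : Set (Set V) :=
  {W | R.IsComp v (R.Ve v \ U) W ∧ Odd (R.hval v W R.c) ∧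
    ∃ y ∈ W, R.par y ∉ W ∧ R.par y ∈ X}

/-- The union of the sets `V_f(t)`, `t ∈ T_e`. -/
def UT (v : V) (f : V → ℕ) : Set V := ⋃ t ∈ R.Te v, R.Vf v f t

/-- The union of the sets `V_f(t)`, `t ∈ T_e ∪ {u}`. -/
def USall (v : V) (f : V → ℕ) : Set V := ⋃ t ∈ R.S v, R.Vf v f t

/-- `f` is a blocking flow in `I(e)`, `e = (par v, v)`: a feasible flow such that
`{V_f(t) : t ∈ T_e}` is a cut-system of `T_e` (pairwise disjoint `t`-sets avoiding the
terminal `u = par v`) each member of which is blocked by `f`, i.e.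
`f(e_t) = f(V_f(t)) = c(V_f(t)) − |odd(V_f(t))|`. -/
def IsBlocking (v : V) (f : V → ℕ) : Prop :=
  R.IsFlow v f ∧ R.Feasible v f ∧
  (∀ t ∈ R.Te v, R.par v ∉ R.Vf v f t) ∧
  (∀ t ∈ R.Te v, ∀ t' ∈ R.Te v, t ≠ t' → R.Vf v f t ∩ R.Vf v f t' = ∅) ∧
  (∀ t ∈ R.Te v, f t = R.hval v (R.Vf v f t) f ∧
    R.hval v (R.Vf v f t) f + (R.oddOf v (R.UT v f) (R.Vf v f t)).ncard
      = R.hval v (R.Vf v f t) R.c)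

/-- `Ψ(e)`: the set of values `f(e)` of blocking flows `f` of `I(e)`, `e = (par v, v)`. -/
def Psi (v : V) : Set ℕ := {x | ∃ f, R.IsBlocking v f ∧ f v = x}

/-- `a(e)`: the least element of `Ψ(e)`. -/
noncomputable def aE (v : V) : ℕ := sInf (R.Psi v)

/-- `b(e)`: the greatest element of `Ψ(e)`. -/
noncomputable def bE (v : V) : ℕ := sSup (R.Psi v)

/-- The edge `(par x, x)` is dominating: `b(e') + 2 ≤ a(e)` for its sibling edge `e'`. -/
def Dominating (x : V) : Prop :=
  x ≠ R.root ∧ ∃ y, y ≠ R.root ∧ y ≠ x ∧ R.par y = R.par x ∧ R.bE y + 2 ≤ R.aE x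

/-- The path from `v` down to `t` consists of dominating edges. -/
def DomPath (v t : V) : Prop :=
  R.below v t ∧ ∀ x, R.below v x → R.below x t → x ≠ v → R.Dominating x

/-- Condition (a) for the edge `e = (par v, v)`. -/
def CondA (v : V) : Prop :=
  (∃ a b, R.Psi v = Iv a b) ∧
  (R.leaf v → R.Psi v = {R.c v}) ∧
  (∀ w₁ w₂, w₁ ≠ w₂ → R.children v = {w₁, w₂} →
    R.Psi v = (otimes (R.Psi w₁) (R.Psi w₂) ∩ Set.Iic (R.c v)) ∪ {R.c v})

/-- Condition (b) for the edge `e = (u,v)`: if `e` has a dominating child-edge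
`e' = (v,w)`, then there is a terminal `t ∈ T_{e'}` with `g(u,t) ≥ a(e)` for every
decomposition `g` of every blocking flow of `I(e)`, and `P_{v,t}` a dominating path. -/
def CondB (v : V) : Prop :=
  ∀ w ∈ R.children v, R.Dominating w →
    ∃ t ∈ R.Te w, R.DomPath v t ∧
      ∀ f g, R.IsBlocking v f → R.IsDecomp v f g → R.aE v ≤ g s(R.par v, t)

/-- `γ(𝒳)` for the cut-system `𝒳 = {V_f(t) : t ∈ T_e ∪ {u}}`. -/
noncomputable def gammaX (v : V) (f : V → ℕ) : ℕ :=
  ∑ᶠ t ∈ R.S v, R.hval v (R.Vf v f t) R.c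

/-- `κ(𝒳)` for the cut-system `𝒳 = {V_f(t) : t ∈ T_e ∪ {u}}`: the number of
components of `G_e − ∪𝒳` of odd capacity. -/
noncomputable def kappaX (v : V) (f : V → ℕ) : ℕ :=
  {W : Set V | R.IsComp v (R.Ve v \ R.USall v f) W ∧ Odd (R.hval v W R.c)}.ncard

end RTI

namespace RTI

section Tree

variable {V : Type*} {R : RTI V} {a b u v w x z t : V}

lemma below.refl (R : RTI V) (v : V) : R.below v v := Relation.ReflTransGen.refl

lemma below.trans (h : R.below a b) (h' : R.below b x) : R.below a x :=
  Relation.ReflTransGen.trans h h'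

lemma below_of_par (hw : w ≠ R.root) : R.below (R.par w) w :=
  Relation.ReflTransGen.single ⟨rfl, hw⟩

lemma below.eq_or_par (h : R.below a b) : a = b ∨ (R.below a (R.par b) ∧ b ≠ R.root) := by
  rcases Relation.ReflTransGen.cases_tail h with h | ⟨c, hc, rfl, hb⟩
  · exact Or.inl h.symm
  · exact Or.inr ⟨hc, hb⟩

lemma below.eq_or_child (h : R.below a b) : a = b ∨ ∃ w ∈ R.children a, R.below w b := by
  rcases Relation.ReflTransGen.cases_head h with h | ⟨c, hc, h⟩
  · exact Or.inl h
  · exact Or.inr ⟨c, hc, h⟩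

lemma below.eq_or_dep_lt (h : R.below a b) : a = b ∨ R.dep a < R.dep b := by
  induction h with
  | refl => exact Or.inl rfl
  | tail _ hbc ih =>
    obtain ⟨rfl, hc⟩ := hbc
    have := R.dep_par _ hc
    right
    rcases ih with rfl | h <;> omega

lemma below.antisymm (h : R.below a b) (h' : R.below b a) : a = b := by
  rcases h.eq_or_dep_lt with h | h
  · exact h
  · rcases h'.eq_or_dep_lt with h' | h'
    · exact h'.symm
    · omega

lemma below.dep_le (h : R.below a b) : R.dep a ≤ R.dep b := by
  rcases h.eq_or_dep_lt with rfl | h <;> omega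

lemma below.total (h : R.below a x) (h' : R.below b x) : R.below a b ∨ R.below b a := by
  induction h with
  | refl => exact Or.inr h'
  | tail hab hbc ih =>
    obtain ⟨rfl, hc⟩ := hbc
    rcases h'.eq_or_par with rfl | ⟨h', -⟩
    · exact Or.inl (hab.trans (below_of_par hc))
    · exact ih h'

lemma not_below_par (hw : w ≠ R.root) : ¬ R.below w (R.par w) := fun h => by
  have := h.dep_le
  have := R.dep_par w hw
  omega

lemma below.ne_root (h : R.below a b) (ha : a ≠ R.root) : b ≠ R.root := by
  rcases h.eq_or_par with rfl | h
  · exact ha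
  · exact h.2

lemma not_below_of_sibling (hab : a ≠ b) (ha : a ≠ R.root) (hb : b ≠ R.root)
    (hp : R.par a = R.par b) (h : R.below a x) : ¬ R.below b x := fun h' => by
  have h₁ := R.dep_par a ha
  have h₂ := R.dep_par b hb
  rw [hp] at h₁
  rcases h.total h' with h | h <;> rcases h.eq_or_dep_lt with h | h
  · exact hab h
  · omega
  · exact hab h.symm
  · omega

lemma mem_Ve_par_of_below (h : R.below w x) : R.par x ∈ R.Ve w := by
  rcases h.eq_or_par with rfl | h
  · exact Or.inl rfl
  · exact Or.inr h.1

lemma Ve_subset_of_child (hw : w ≠ R.root) : R.Ve w ⊆ R.Ve (R.par w) := by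
  rintro z (rfl | hz)
  · exact Or.inr (below.refl R _)
  · exact Or.inr ((below_of_par hw).trans hz)

end Tree

section Subinstance

variable {V : Type*} {R : RTI V} {w t : V} {f f' : V → ℕ}

lemma Vf_subset_below (hp : R.par w ∉ R.Vf w f t) :
    ∀ z ∈ R.Vf w f t, R.below w z := by
  rintro z ⟨-, q, hq, hqt, hqz, hup, hdown⟩
  rcases hq with rfl | hq
  · refine absurd ⟨Or.inl rfl, R.par w, Or.inl rfl, hqt, below.refl R _, hup, ?_⟩ hp
    intro x h₁ h₂ h₃
    exact absurd (h₁.antisymm h₂).symm h₃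
  · exact hq.trans hqz

lemma Vf_par_eq (hw : w ≠ R.root) (hff : ∀ z, R.below w z → f z = f' z)
    (ht : t ∈ R.Te w) (hp : R.par w ∉ R.Vf w f' t) :
    R.Vf (R.par w) f t = R.Vf w f' t := by
  ext z
  constructor
  · rintro ⟨-, q, hq, hqt, hqz, hup, hdown⟩
    rcases ht.1.total hqt with hwq | hqw
    · refine ⟨Or.inr (hwq.trans hqz), q, Or.inr hwq, hqt, hqz, ?_, ?_⟩
      · intro x h₁ h₂ h₃
        rw [← hff x (hwq.trans h₁)]
        exact hup x h₁ h₂ h₃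
      · intro x h₁ h₂ h₃
        rw [← hff x (hwq.trans h₁)]
        exact hdown x h₁ h₂ h₃
    · rcases hqw.eq_or_par with rfl | ⟨hqv, -⟩
      · refine ⟨Or.inr hqz, q, Or.inr (below.refl R _), hqt, hqz, ?_, ?_⟩
        · intro x h₁ h₂ h₃
          rw [← hff x h₁]
          exact hup x h₁ h₂ h₃
        · intro x h₁ h₂ h₃
          rw [← hff x h₁]
          exact hdown x h₁ h₂ h₃
      · refine absurd ⟨Or.inl rfl, R.par w, Or.inl rfl, (below_of_par hw).trans ht.1,
          below.refl R _, ?_, ?_⟩ hp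
        · intro x h₁ h₂ h₃
          have hwx : R.below w x := by
            rcases ht.1.total h₂ with h | h
            · exact h
            · rcases h.eq_or_par with rfl | h
              · exact below.refl R _
              · exact absurd (h.1.antisymm h₁) h₃
          rw [← hff x hwx]
          refine hup x (hqv.trans h₁) h₂ ?_
          rintro rfl
          exact h₃ (hqv.antisymm h₁)
        · intro x h₁ h₂ h₃
          exact absurd (h₁.antisymm h₂).symm h₃
  · intro hz
    have hwz := Vf_subset_below hp z hz
    obtain ⟨hz', q, hq, hqt, hqz, hup, hdown⟩ := hz
    have hwq : R.below w q := by
      rcases hq with rfl | hq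
      · refine absurd ⟨Or.inl rfl, R.par w, Or.inl rfl, hqt, below.refl R _, hup, ?_⟩ hp
        intro x h₁ h₂ h₃
        exact absurd (h₁.antisymm h₂).symm h₃
      · exact hq
    refine ⟨Ve_subset_of_child hw hz', q, Ve_subset_of_child hw hq, hqt, hqz, ?_, ?_⟩
    · intro x h₁ h₂ h₃
      rw [hff x (hwq.trans h₁)]
      exact hup x h₁ h₂ h₃
    · intro x h₁ h₂ h₃
      rw [hff x (hwq.trans h₁)]
      exact hdown x h₁ h₂ h₃

variable {X : Set V}

lemma below_of_par_mem (hv : R.par w ≠ R.root) (hX : ∀ z ∈ X, R.below w z) {x : V}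
    (hx : R.below (R.par w) x) (h : R.par x ∈ X) : R.below w x :=
  (hX _ h).trans (below_of_par (hx.ne_root hv))

lemma cutE_par_eq (hw : w ≠ R.root) (hv : R.par w ≠ R.root) (hX : ∀ z ∈ X, R.below w z) :
    R.cutE (R.par w) X = R.cutE w X := by
  ext x
  refine ⟨fun ⟨h₁, h₂⟩ => ⟨?_, h₂⟩, fun ⟨h₁, h₂⟩ => ⟨(below_of_par hw).trans h₁, h₂⟩⟩
  by_cases hx : x ∈ X
  · exact hX x hx
  · refine below_of_par_mem hv hX h₁ ?_
    by_contra h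
    exact h₂ (by simp [hx, h])

lemma hval_par_eq (hw : w ≠ R.root) (hv : R.par w ≠ R.root) (hX : ∀ z ∈ X, R.below w z)
    (hff : ∀ z, R.below w z → f z = f' z) :
    R.hval (R.par w) X f = R.hval w X f' := by
  unfold hval
  rw [cutE_par_eq hw hv hX]
  exact finsum_mem_congr rfl fun x hx => hff x hx.1

lemma ConnSet.below_top {W : Set V} (hW : R.ConnSet W) {y : V} (hy : y ∈ W)
    (hpy : R.par y ∉ W) : y ≠ R.root ∧ ∀ z ∈ W, R.below y z := by
  have hyr : y ≠ R.root := by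
    rintro rfl
    exact hpy (by rwa [R.par_root])
  refine ⟨hyr, fun z hz => ?_⟩
  by_contra h
  refine hpy (hW y hy z hz _ ⟨Or.inl (below_of_par hyr), fun q hqy hqz => ?_⟩)
  rcases hqy.eq_or_par with rfl | hq
  · exact absurd hqz h
  · exact hq.1

lemma isComp_par_iff (hw : w ≠ R.root) (hv : R.par w ≠ R.root) {U U' : Set V}
    (hU : ∀ z ∈ R.Ve w, z ∈ U ↔ z ∈ U') {W : Set V} (hW : ∀ z ∈ W, R.below w z) :
    R.IsComp (R.par w) (R.Ve (R.par w) \ U) W ↔ R.IsComp w (R.Ve w \ U') W := by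
  have hA : ∀ z ∈ R.Ve w, z ∈ R.Ve (R.par w) \ U ↔ z ∈ R.Ve w \ U' := fun z hz => by
    simp [hz, Ve_subset_of_child hw hz, hU z hz]
  constructor
  · rintro ⟨h₁, h₂, h₃, h₄, h₅⟩
    refine ⟨h₁, fun z hz => (hA z (Or.inr (hW z hz))).1 (h₂ hz), h₃, ?_, ?_⟩
    · intro x hx hxW hp
      exact h₄ x ((below_of_par hw).trans hx) hxW ((hA _ (mem_Ve_par_of_below hx)).2 hp)
    · intro x hx hp hxA
      exact h₅ x ((below_of_par hw).trans hx) hp ((hA _ (Or.inr hx)).2 hxA)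
  · rintro ⟨h₁, h₂, h₃, h₄, h₅⟩
    refine ⟨h₁, fun z hz => (hA z (Or.inr (hW z hz))).2 (h₂ hz), h₃, ?_, ?_⟩
    · intro x hx hxW hp
      exact h₄ x (hW x hxW) hxW ((hA _ (mem_Ve_par_of_below (hW x hxW))).1 hp)
    · intro x hx hp hxA
      have hx' := below_of_par_mem hv hW hx hp
      exact h₅ x hx' hp ((hA _ (Or.inr hx')).1 hxA)

lemma oddOf_par_eq (hw : w ≠ R.root) (hv : R.par w ≠ R.root) {U U' : Set V}
    (hU : ∀ z ∈ R.Ve w, z ∈ U ↔ z ∈ U') (hX : ∀ z ∈ X, R.below w z) :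
    R.oddOf (R.par w) U X = R.oddOf w U' X := by
  have key : ∀ W, R.ConnSet W → (∃ y ∈ W, R.par y ∉ W ∧ R.par y ∈ X) →
      ∀ z ∈ W, R.below w z := by
    rintro W hW ⟨y, hy, hpy, hpX⟩ z hz
    obtain ⟨hyr, h⟩ := hW.below_top hy hpy
    exact ((hX _ hpX).trans (below_of_par hyr)).trans (h z hz)
  ext W
  constructor
  · rintro ⟨h₁, h₂, h₃⟩
    have hW := key W h₁.2.2.1 h₃
    refine ⟨(isComp_par_iff hw hv hU hW).1 h₁, ?_, h₃⟩
    rwa [hval_par_eq hw hv hW fun _ _ => rfl] at h₂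
  · rintro ⟨h₁, h₂, h₃⟩
    have hW := key W h₁.2.2.1 h₃
    refine ⟨(isComp_par_iff hw hv hU hW).2 h₁, ?_, h₃⟩
    rwa [hval_par_eq hw hv hW fun _ _ => rfl]

end Subinstance

section Flow

variable {V : Type*} {R : RTI V}

/-- The edge `(par w, w)` lies on the tree path joining the two members of `p`. -/
def Crosses (R : RTI V) (w : V) (p : Sym2 V) : Prop := ∃ t t', p = s(t, t') ∧ R.onPath w t t'

lemma crosses_mk {w a b : V} : R.Crosses w s(a, b) ↔ R.onPath w a b := by
  constructor
  · rintro ⟨t, t', h, hp⟩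
    rcases Sym2.eq_iff.1 h with ⟨rfl, rfl⟩ | ⟨rfl, rfl⟩
    · exact hp
    · unfold onPath at *
      tauto
  · exact fun h => ⟨a, b, rfl, h⟩

lemma finsum_count_eq_countP {α : Type*} [Finite α] [DecidableEq α] (M : Multiset α) (P : α → Prop) :
    ∑ᶠ p ∈ {p | P p}, M.count p = M.countP P := by
  have := Fintype.ofFinite α
  rw [finsum_mem_eq_finite_toFinset_sum _ (Set.toFinite _), Multiset.countP_eq_card_filter]
  rw [← Multiset.sum_count_eq_card (s := (Set.toFinite {p | P p}).toFinset)]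
  · refine Finset.sum_congr rfl fun p hp => ?_
    rw [Multiset.count_filter_of_pos]
    simpa using hp
  · intro a ha
    simpa using (Multiset.mem_filter.1 ha).2

lemma isFlow_iff_exists_multiset [Finite V] {v : V} {f : V → ℕ} :
    R.IsFlow v f ↔ ∃ M : Multiset (Sym2 V), (∀ p ∈ M, p ∈ R.PathPairs v) ∧
      ∀ w, R.below v w → f w = M.countP (R.Crosses w) := by
  constructor
  · rintro ⟨g, hg, hf⟩
    have hcount : ∀ p, (Finsupp.toMultiset (Finsupp.equivFunOnFinite.symm g)).count p = g p := by
      intro p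
      rw [Finsupp.count_toMultiset]
      rfl
    refine ⟨Finsupp.toMultiset (Finsupp.equivFunOnFinite.symm g), ?_, ?_⟩
    · intro p hp
      apply hg
      rw [← hcount p]
      exact Multiset.count_ne_zero.2 hp
    · intro w hw
      rw [hf w hw, ← finsum_count_eq_countP]
      simp only [hcount]
      rfl
  · rintro ⟨M, hM, hf⟩
    refine ⟨fun p => M.count p, fun p hp => hM p (Multiset.count_ne_zero.1 hp), ?_⟩
    intro w hw
    rw [hf w hw, ← finsum_count_eq_countP]
    rfl

lemma exists_list_map_eq {α β : Type*} (φ : α → β) (M : Multiset β)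
    (h : ∀ p ∈ M, ∃ a, φ a = p) : ∃ A : List α, (A.map φ : Multiset β) = M := by
  induction M using Multiset.induction with
  | empty => exact ⟨[], rfl⟩
  | cons p M ih =>
    obtain ⟨A, hA⟩ := ih fun q hq => h q (Multiset.mem_cons_of_mem hq)
    obtain ⟨a, ha⟩ := h p (Multiset.mem_cons_self _ _)
    exact ⟨a :: A, by simp [← hA, ha]⟩

lemma not_par_mem_Te {w : V} (hw : w ≠ R.root) : R.par w ∉ R.Te w :=
  fun h => not_below_par hw h.1

lemma below.not_below_par {w x : V} (hw : w ≠ R.root) (hx : R.below w x) :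
    ¬ R.below x (R.par w) := fun h => RTI.not_below_par hw (hx.trans h)

/-- A flow in `I(e)` is made of paths joining members of `T_e` and of paths that leave
through `e`, the latter being listed by their lower ends. -/
lemma IsFlow.exists_split [Finite V] {w : V} {f : V → ℕ} (hw : w ≠ R.root)
    (hf : R.IsFlow w f) :
    ∃ (N : Multiset (Sym2 V)) (A : List V),
      (∀ p ∈ N, ∃ t ∈ R.Te w, ∃ t' ∈ R.Te w, t ≠ t' ∧ p = s(t, t')) ∧
      (∀ t ∈ A, t ∈ R.Te w) ∧ A.length = f w ∧
      ∀ z, R.below w z → f z = N.countP (R.Crosses z) + A.countP (R.below z ·) := by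
  obtain ⟨M, hM, hfM⟩ := isFlow_iff_exists_multiset.1 hf
  obtain ⟨A, hA⟩ := exists_list_map_eq (fun t => s(R.par w, t)) (M.filter (R.par w ∈ ·))
    (fun p hp => by
      obtain ⟨t, ht⟩ := Sym2.mem_iff_exists.1 (Multiset.mem_filter.1 hp).2
      exact ⟨t, ht.symm⟩)
  have hN : ∀ p ∈ M.filter (R.par w ∉ ·),
      ∃ t ∈ R.Te w, ∃ t' ∈ R.Te w, t ≠ t' ∧ p = s(t, t') := by
    intro p hp
    obtain ⟨hpM, hp⟩ := Multiset.mem_filter.1 hp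
    obtain ⟨t, t', ht, ht', hne, rfl⟩ := hM p hpM
    rcases ht with rfl | ht
    · simp at hp
    · rcases ht' with rfl | ht'
      · simp at hp
      · exact ⟨t, ht, t', ht', hne, rfl⟩
  have hAT : ∀ t ∈ A, t ∈ R.Te w := by
    intro t ht
    have : s(R.par w, t) ∈ M.filter (R.par w ∈ ·) := by
      rw [← hA]
      exact Multiset.mem_coe.2 (List.mem_map_of_mem ht)
    obtain ⟨a, b, ha, hb, hne, hab⟩ := hM _ (Multiset.mem_filter.1 this).1
    rcases Sym2.eq_iff.1 hab with ⟨rfl, rfl⟩ | ⟨rfl, rfl⟩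
    · exact hb.resolve_left fun h => hne h.symm
    · exact ha.resolve_left hne
  have hsum : ∀ z, R.below w z → f z =
      (M.filter (R.par w ∉ ·)).countP (R.Crosses z) + A.countP (R.below z ·) := by
    intro z hz
    rw [hfM z hz]
    conv_lhs => rw [← Multiset.filter_add_not (R.par w ∈ ·) M]
    rw [Multiset.countP_add, ← hA, add_comm]
    congr 1
    rw [Multiset.coe_countP, List.countP_map]
    refine List.countP_congr fun t _ => ?_
    have := hz.not_below_par hw
    simp [crosses_mk, onPath, this]
  refine ⟨_, A, hN, hAT, ?_, hsum⟩
  rw [hsum w (below.refl R w), Multiset.countP_eq_zero.2, List.countP_eq_length.2, zero_add]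
  · intro t ht
    simpa using (hAT t ht).1
  · intro p hp
    obtain ⟨t, ht, t', ht', -, rfl⟩ := hN p hp
    rw [crosses_mk]
    have h₁ := ht.1
    have h₂ := ht'.1
    unfold onPath
    tauto

lemma countP_crosses_eq_zero {N : Multiset (Sym2 V)} {T : Set V} {z : V}
    (hN : ∀ p ∈ N, ∃ t ∈ T, ∃ t' ∈ T, t ≠ t' ∧ p = s(t, t'))
    (h : (∀ t ∈ T, ¬ R.below z t) ∨ ∀ t ∈ T, R.below z t) : N.countP (R.Crosses z) = 0 := by
  refine Multiset.countP_eq_zero.2 fun p hp => ?_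
  obtain ⟨t, ht, t', ht', -, rfl⟩ := hN p hp
  rw [crosses_mk]
  unfold onPath
  rcases h with h | h <;> have h₁ := h t ht <;> have h₂ := h t' ht' <;> tauto

lemma exists_zip {α : Type*} (A B : List α) (h : A.length = B.length) :
    ∃ Z : List (α × α), Z.map Prod.fst = A ∧ Z.map Prod.snd = B :=
  ⟨A.zip B, List.map_fst_zip h.le, List.map_snd_zip h.ge⟩

/-- Flows in the instances of two sibling edges are glued to a flow in the instance of
their parent edge, joining `y` paths from each side to each other. -/
lemma IsFlow.glue [Finite V] {v w₁ w₂ : V} (hv : v ≠ R.root) (h₁ : w₁ ≠ R.root)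
    (h₂ : w₂ ≠ R.root) (hw : w₁ ≠ w₂) (hp₁ : R.par w₁ = v) (hp₂ : R.par w₂ = v)
    (hbelow : ∀ z, R.below v z → z = v ∨ R.below w₁ z ∨ R.below w₂ z)
    {f f₁ f₂ : V → ℕ} (hf₁ : R.IsFlow w₁ f₁) (hf₂ : R.IsFlow w₂ f₂) {y : ℕ}
    (hy₁ : y ≤ f₁ w₁) (hy₂ : y ≤ f₂ w₂) (hfv : f v = f₁ w₁ + f₂ w₂ - 2 * y)
    (e₁ : ∀ z, R.below w₁ z → f z = f₁ z) (e₂ : ∀ z, R.below w₂ z → f z = f₂ z) :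
    R.IsFlow v f := by
  obtain ⟨N₁, A₁, hN₁, hA₁, hl₁, hs₁⟩ := hf₁.exists_split h₁
  obtain ⟨N₂, A₂, hN₂, hA₂, hl₂, hs₂⟩ := hf₂.exists_split h₂
  obtain ⟨Z, hZ₁, hZ₂⟩ := exists_zip (A₁.take y) (A₂.take y) (by simp; omega)
  have hv₁ : R.below v w₁ := hp₁ ▸ below_of_par h₁
  have hv₂ : R.below v w₂ := hp₂ ▸ below_of_par h₂
  have hdisj : ∀ z, R.below w₁ z → ¬ R.below w₂ z :=
    fun z => not_below_of_sibling hw h₁ h₂ (hp₁.trans hp₂.symm)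
  have hT₁ : R.Te w₁ ⊆ R.Te v := fun t ht => ⟨hv₁.trans ht.1, ht.2⟩
  have hT₂ : R.Te w₂ ⊆ R.Te v := fun t ht => ⟨hv₂.trans ht.1, ht.2⟩
  have hZm : ∀ q ∈ Z, q.1 ∈ R.Te w₁ ∧ q.2 ∈ R.Te w₂ := by
    intro q hq
    constructor
    · exact hA₁ _ (List.mem_of_mem_take (hZ₁ ▸ List.mem_map_of_mem hq))
    · exact hA₂ _ (List.mem_of_mem_take (hZ₂ ▸ List.mem_map_of_mem hq))
  set C : List V := A₁.drop y ++ A₂.drop y with hC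
  have hCm : ∀ t ∈ C, t ∈ R.Te v := by
    intro t ht
    rcases List.mem_append.1 ht with ht | ht
    · exact hT₁ (hA₁ _ (List.mem_of_mem_drop ht))
    · exact hT₂ (hA₂ _ (List.mem_of_mem_drop ht))
  have hsplit : ∀ z, ∀ A : List V, A.countP (R.below z ·) =
      (A.take y).countP (R.below z ·) + (A.drop y).countP (R.below z ·) := by
    intro z A
    rw [← List.countP_append, List.take_append_drop]
  have hCc : ∀ z, R.below v z →
      (C.map fun t => s(R.par v, t)).countP (R.Crosses z) = C.countP (R.below z ·) := by
    intro z hz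
    rw [List.countP_map]
    refine List.countP_congr fun t _ => ?_
    have := hz.not_below_par hv
    simp [crosses_mk, onPath, this]
  refine isFlow_iff_exists_multiset.2
    ⟨N₁ + N₂ + (C.map fun t => s(R.par v, t) : List (Sym2 V)) +
      (Z.map fun q => s(q.1, q.2) : List (Sym2 V)), ?_, ?_⟩
  · intro p hp
    simp only [Multiset.mem_add, Multiset.mem_coe, List.mem_map] at hp
    rcases hp with ((hp | hp) | ⟨t, ht, rfl⟩) | ⟨q, hq, rfl⟩
    · obtain ⟨t, ht, t', ht', hne, rfl⟩ := hN₁ p hp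
      exact ⟨t, t', Or.inr (hT₁ ht), Or.inr (hT₁ ht'), hne, rfl⟩
    · obtain ⟨t, ht, t', ht', hne, rfl⟩ := hN₂ p hp
      exact ⟨t, t', Or.inr (hT₂ ht), Or.inr (hT₂ ht'), hne, rfl⟩
    · refine ⟨_, t, Or.inl rfl, Or.inr (hCm t ht), ?_, rfl⟩
      rintro rfl
      exact not_par_mem_Te hv (hCm _ ht)
    · obtain ⟨hq₁, hq₂⟩ := hZm q hq
      refine ⟨_, _, Or.inr (hT₁ hq₁), Or.inr (hT₂ hq₂), ?_, rfl⟩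
      intro h
      exact hdisj _ hq₁.1 (h ▸ hq₂.1)
  · intro z hz
    simp only [Multiset.countP_add, Multiset.coe_countP]
    rw [hCc z hz]
    rcases hbelow z hz with rfl | hz₁ | hz₂
    · rw [countP_crosses_eq_zero hN₁ (Or.inr fun t ht => (hT₁ ht).1),
        countP_crosses_eq_zero hN₂ (Or.inr fun t ht => (hT₂ ht).1),
        List.countP_eq_length.2 (fun t ht => by simpa using (hCm t ht).1),
        List.countP_eq_zero.2, hC, hfv]
      · simp only [List.length_append, List.length_drop]
        omega
      · intro p hp
        obtain ⟨q, hq, rfl⟩ := List.mem_map.1 hp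
        have h₁ := (hT₁ (hZm q hq).1).1
        have h₂ := (hT₂ (hZm q hq).2).1
        simp [crosses_mk, onPath, h₁, h₂]
    · have hn : ∀ t ∈ R.Te w₂, ¬ R.below z t := fun t ht h => hdisj t (hz₁.trans h) ht.1
      have hZc : (Z.map fun q => s(q.1, q.2)).countP (R.Crosses z) =
          (A₁.take y).countP (R.below z ·) := by
        rw [← hZ₁, List.countP_map, List.countP_map]
        refine List.countP_congr fun q hq => ?_
        have := hn _ (hZm q hq).2
        simp [crosses_mk, onPath, this]
      have hd : (A₂.drop y).countP (R.below z ·) = 0 :=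
        List.countP_eq_zero.2 fun t ht => by
          simpa using hn t (hA₂ t (List.mem_of_mem_drop ht))
      rw [countP_crosses_eq_zero hN₂ (Or.inl hn), hZc, hC, List.countP_append, hd, e₁ z hz₁,
        hs₁ z hz₁, hsplit z A₁]
      omega
    · have hn : ∀ t ∈ R.Te w₁, ¬ R.below z t := fun t ht h => hdisj t ht.1 (hz₂.trans h)
      have hZc : (Z.map fun q => s(q.1, q.2)).countP (R.Crosses z) =
          (A₂.take y).countP (R.below z ·) := by
        rw [← hZ₂, List.countP_map, List.countP_map]
        refine List.countP_congr fun q hq => ?_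
        have := hn _ (hZm q hq).1
        simp [crosses_mk, onPath, this]
      have hd : (A₁.drop y).countP (R.below z ·) = 0 :=
        List.countP_eq_zero.2 fun t ht => by
          simpa using hn t (hA₁ t (List.mem_of_mem_drop ht))
      rw [countP_crosses_eq_zero hN₁ (Or.inl hn), hZc, hC, List.countP_append, hd, e₂ z hz₂,
        hs₂ z hz₂, hsplit z A₂]
      omega

end Flow

section Blocking

variable {V : Type*} {R : RTI V} {w t : V} {f f' : V → ℕ}

lemma IsBlocking.Vf_par_eq (hw : w ≠ R.root) (hf' : R.IsBlocking w f')
    (hff : ∀ z, R.below w z → f z = f' z) (ht : t ∈ R.Te w) :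
    R.Vf (R.par w) f t = R.Vf w f' t :=
  RTI.Vf_par_eq hw hff ht (hf'.2.2.1 t ht)

lemma IsBlocking.Vf_subset_below (hf' : R.IsBlocking w f') (ht : t ∈ R.Te w) :
    ∀ z ∈ R.Vf w f' t, R.below w z :=
  RTI.Vf_subset_below (hf'.2.2.1 t ht)

lemma IsBlocking.UT_subset_below (hf' : R.IsBlocking w f') :
    ∀ z ∈ R.UT w f', R.below w z := by
  intro z hz
  obtain ⟨t, ht, hz⟩ := Set.mem_iUnion₂.1 hz
  exact hf'.Vf_subset_below ht z hz

lemma IsBlocking.blocked_par (hw : w ≠ R.root) (hv : R.par w ≠ R.root)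
    (hf' : R.IsBlocking w f') (hff : ∀ z, R.below w z → f z = f' z)
    (hU : ∀ z ∈ R.Ve w, z ∈ R.UT (R.par w) f ↔ z ∈ R.UT w f') (ht : t ∈ R.Te w) :
    f t = R.hval (R.par w) (R.Vf (R.par w) f t) f ∧
    R.hval (R.par w) (R.Vf (R.par w) f t) f +
        (R.oddOf (R.par w) (R.UT (R.par w) f) (R.Vf (R.par w) f t)).ncard
      = R.hval (R.par w) (R.Vf (R.par w) f t) R.c := by
  have hX := hf'.Vf_subset_below ht
  rw [hf'.Vf_par_eq hw hff ht, hval_par_eq hw hv hX hff, oddOf_par_eq hw hv hU hX,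
    hval_par_eq hw hv hX (fun _ _ => rfl : ∀ z, R.below w z → R.c z = R.c z), hff t ht.1]
  exact hf'.2.2.2.2 t ht

lemma UT_par_eq {w₁ w₂ v : V} {f f₁ f₂ : V → ℕ} (hT : R.Te v = R.Te w₁ ∪ R.Te w₂)
    (h₁ : ∀ t ∈ R.Te w₁, R.Vf v f t = R.Vf w₁ f₁ t)
    (h₂ : ∀ t ∈ R.Te w₂, R.Vf v f t = R.Vf w₂ f₂ t) :
    R.UT v f = R.UT w₁ f₁ ∪ R.UT w₂ f₂ := by
  unfold UT
  rw [hT, Set.biUnion_union]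
  exact congrArg₂ _ (Set.iUnion₂_congr h₁) (Set.iUnion₂_congr h₂)

/-- Blocking flows in the instances of two sibling edges are glued to a blocking flow in
the instance of their parent edge. -/
lemma IsBlocking.glue [Finite V] {v w₁ w₂ : V} (hv : v ≠ R.root) (hw : w₁ ≠ w₂)
    (hch : R.children v = {w₁, w₂}) {f f₁ f₂ : V → ℕ} (hf₁ : R.IsBlocking w₁ f₁)
    (hf₂ : R.IsBlocking w₂ f₂) {y : ℕ} (hy₁ : y ≤ f₁ w₁) (hy₂ : y ≤ f₂ w₂)
    (hfv : f v = f₁ w₁ + f₂ w₂ - 2 * y) (hcv : f v ≤ R.c v)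
    (e₁ : ∀ z, R.below w₁ z → f z = f₁ z) (e₂ : ∀ z, R.below w₂ z → f z = f₂ z) :
    R.IsBlocking v f := by
  obtain ⟨hp₁, h₁⟩ : w₁ ∈ R.children v := by simp [hch]
  obtain ⟨hp₂, h₂⟩ : w₂ ∈ R.children v := by simp [hch]
  have hbelow : ∀ z, R.below v z → z = v ∨ R.below w₁ z ∨ R.below w₂ z := by
    intro z hz
    rcases hz.eq_or_child with rfl | ⟨w, hw, hz⟩
    · exact Or.inl rfl
    · rw [hch] at hw
      rcases hw with rfl | rfl
      · exact Or.inr (Or.inl hz)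
      · exact Or.inr (Or.inr hz)
  have hdisj : ∀ z, R.below w₁ z → ¬ R.below w₂ z :=
    fun z => not_below_of_sibling hw h₁ h₂ (hp₁.trans hp₂.symm)
  have hT : R.Te v = R.Te w₁ ∪ R.Te w₂ := by
    ext t
    constructor
    · rintro ⟨ht, hl⟩
      rcases hbelow t ht with rfl | h | h
      · exact absurd hp₁ (hl.2 w₁ h₁)
      · exact Or.inl ⟨h, hl⟩
      · exact Or.inr ⟨h, hl⟩
    · rintro (⟨ht, hl⟩ | ⟨ht, hl⟩)
      · exact ⟨(hp₁ ▸ below_of_par h₁ : R.below v w₁).trans ht, hl⟩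
      · exact ⟨(hp₂ ▸ below_of_par h₂ : R.below v w₂).trans ht, hl⟩
  have hV₁ : ∀ t ∈ R.Te w₁, R.Vf v f t = R.Vf w₁ f₁ t :=
    fun t ht => hp₁ ▸ hf₁.Vf_par_eq h₁ e₁ ht
  have hV₂ : ∀ t ∈ R.Te w₂, R.Vf v f t = R.Vf w₂ f₂ t :=
    fun t ht => hp₂ ▸ hf₂.Vf_par_eq h₂ e₂ ht
  have hU := UT_par_eq hT hV₁ hV₂
  have hn₁ : ¬ R.below w₁ v := hp₁ ▸ not_below_par h₁
  have hn₂ : ¬ R.below w₂ v := hp₂ ▸ not_below_par h₂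
  have hU₁ : ∀ z ∈ R.Ve w₁, z ∈ R.UT v f ↔ z ∈ R.UT w₁ f₁ := by
    intro z hz
    rw [hU]
    refine ⟨fun h => h.resolve_right fun h => ?_, Or.inl⟩
    have hz₂ := hf₂.UT_subset_below z h
    rcases hz with rfl | hz
    · exact hn₂ (hp₁ ▸ hz₂)
    · exact hdisj z hz hz₂
  have hU₂ : ∀ z ∈ R.Ve w₂, z ∈ R.UT v f ↔ z ∈ R.UT w₂ f₂ := by
    intro z hz
    rw [hU]
    refine ⟨fun h => h.resolve_left fun h => ?_, Or.inr⟩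
    have hz₁ := hf₁.UT_subset_below z h
    rcases hz with rfl | hz
    · exact hn₁ (hp₂ ▸ hz₁)
    · exact hdisj z hz₁ hz
  have hVdisj : ∀ t ∈ R.Te w₁, ∀ t' ∈ R.Te w₂, R.Vf w₁ f₁ t ∩ R.Vf w₂ f₂ t' = ∅ := by
    intro t ht t' ht'
    refine Set.eq_empty_of_forall_notMem fun z hz => ?_
    exact hdisj z (hf₁.Vf_subset_below ht z hz.1) (hf₂.Vf_subset_below ht' z hz.2)
  refine ⟨hf₁.1.glue hv h₁ h₂ hw hp₁ hp₂ hbelow hf₂.1 hy₁ hy₂ hfv e₁ e₂, ?_, ?_, ?_, ?_⟩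
  · intro z hz
    rcases hbelow z hz with rfl | hz | hz
    · exact hcv
    · exact e₁ z hz ▸ hf₁.2.1 z hz
    · exact e₂ z hz ▸ hf₂.2.1 z hz
  · intro t ht hm
    have hvv : ¬ R.below v (R.par v) := not_below_par hv
    rw [hT] at ht
    rcases ht with ht | ht
    · rw [hV₁ t ht] at hm
      exact hvv ((hp₁ ▸ below_of_par h₁ : R.below v w₁).trans (hf₁.Vf_subset_below ht _ hm))
    · rw [hV₂ t ht] at hm
      exact hvv ((hp₂ ▸ below_of_par h₂ : R.below v w₂).trans (hf₂.Vf_subset_below ht _ hm))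
  · intro t ht t' ht' hne
    rw [hT] at ht ht'
    rcases ht with ht | ht <;> rcases ht' with ht' | ht'
    · rw [hV₁ t ht, hV₁ t' ht']
      exact hf₁.2.2.2.1 t ht t' ht' hne
    · rw [hV₁ t ht, hV₂ t' ht']
      exact hVdisj t ht t' ht'
    · rw [hV₂ t ht, hV₁ t' ht', Set.inter_comm]
      exact hVdisj t' ht' t ht
    · rw [hV₂ t ht, hV₂ t' ht']
      exact hf₂.2.2.2.1 t ht t' ht' hne
  · intro t ht
    rw [hT] at ht
    rcases ht with ht | ht
    · subst hp₁
      exact hf₁.blocked_par h₁ hv e₁ hU₁ ht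
    · subst hp₂
      exact hf₂.blocked_par h₂ hv e₂ hU₂ ht

end Blocking

end RTI

/-- Main Lemma (iii): with the induction hypotheses of the Main Lemma,
for any `x₁ ∈ Ψ(e₁)`, `x₂ ∈ Ψ(e₂)`, `y ∈ [0, min{x₁,x₂}]`, `x = x₁ + x₂ − 2y`, and
blocking flows `fᵢ` of `I(eᵢ)` with `fᵢ(eᵢ) = xᵢ`, we have `x ≥ ã`; and if
`ã ≤ c(e)` and `x ≤ c(e)` there is a blocking flow `f` of `I(e)` with `f(e) = x`
agreeing with `f₁` on the edges of `G_{e₁}` and with `f₂` on the edges of `G_{e₂}`. -/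
theorem RTI.mainLemma_iii {V : Type*} [Fintype V] [DecidableEq V]
    (R : RTI V) (v : V) (hv : v ≠ R.root)
    (w₁ w₂ : V) (hw : w₁ ≠ w₂) (hch : R.children v = {w₁, w₂})
    (hind : ∀ x, x ≠ R.root → R.dep v < R.dep x → R.CondA x ∧ R.CondB x)
    (ta tb : ℕ) (hab : otimes (R.Psi w₁) (R.Psi w₂) = Iv ta tb)
    (x₁ x₂ y x : ℕ) (hx₁ : x₁ ∈ R.Psi w₁) (hx₂ : x₂ ∈ R.Psi w₂)
    (hy : y ≤ min x₁ x₂) (hx : x = x₁ + x₂ - 2 * y)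
    (f₁ : V → ℕ) (hf₁ : R.IsBlocking w₁ f₁) (hf₁v : f₁ w₁ = x₁)
    (f₂ : V → ℕ) (hf₂ : R.IsBlocking w₂ f₂) (hf₂v : f₂ w₂ = x₂) :
    ta ≤ x ∧
    (ta ≤ R.c v → x ≤ R.c v →
      ∃ f : V → ℕ, R.IsBlocking v f ∧ f v = x ∧
        (∀ z, R.below w₁ z → f z = f₁ z) ∧ (∀ z, R.below w₂ z → f z = f₂ z)) := by
  refine ⟨?_, fun _ hxc => ?_⟩
  · have : x ∈ Iv ta tb := hab ▸ ⟨x₁, hx₁, x₂, hx₂, y, hy, hx⟩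
    exact this.1
  · obtain ⟨hp₁, h₁⟩ : w₁ ∈ R.children v := by simp [hch]
    obtain ⟨hp₂, h₂⟩ : w₂ ∈ R.children v := by simp [hch]
    have hn₁ : ¬ R.below w₁ v := hp₁ ▸ not_below_par h₁
    have hn₂ : ¬ R.below w₂ v := hp₂ ▸ not_below_par h₂
    set f : V → ℕ := fun z =>
      if R.below w₁ z then f₁ z else if R.below w₂ z then f₂ z else x with hf
    have hfv : f v = x := by simp [hf, hn₁, hn₂]
    have e₁ : ∀ z, R.below w₁ z → f z = f₁ z := fun z hz => by simp [hf, hz]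
    have e₂ : ∀ z, R.below w₂ z → f z = f₂ z := fun z hz => by
      have := not_below_of_sibling hw.symm h₂ h₁ (hp₂.trans hp₁.symm) hz
      simp [hf, hz, this]
    refine ⟨f, ?_, hfv, e₁, e₂⟩
    exact hf₁.glue hv hw hch hf₂ (y := y) (by omega) (by omega) (by rw [hfv, hf₁v, hf₂v, hx])
      (hfv ▸ hxc) e₁ e₂
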